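/- Let m ≥ 2, n ≥ 1, 0 ≤ ℓ ≤ m, Λ = (n,…,n,0,…,0) ∈ ℤ^m with ℓ entries equal to n, and let ū, w̄ ∈ {1,…,m−1}^N. If the vector k⃗ = Λ − Σ_{t=1}^N α_{ū_t} ∈ ℤ^m has some entry that is negative or strictly greater than n, then ⟪ū,w̄⟫ = 0. (This reflects that webs with an edge label outside {0,…,n} are zero in the web category, by the exterior relation and the convention on negative labels, so the closed formula evaluates them to 0.) -/

import Mathlib

open LaurentPolynomial Finset

noncomputable section

/-- The quantum integer `[a] = q^(a-1) + q^(a-3) + ⋯ + q^(-a+1)` for `a ≥ 0`,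
with `[a] = -[-a]` for `a < 0`. -/
def qint (a : ℤ) : LaurentPolynomial ℤ :=
  if 0 ≤ a then ∑ i ∈ Finset.range a.toNat, T (a - 1 - 2 * i)
  else - ∑ i ∈ Finset.range (-a).toNat, T (-a - 1 - 2 * i)

/-- The quantum factorial `[b]! = [b][b-1]⋯[1]`. -/
def qfac (b : ℕ) : LaurentPolynomial ℤ :=
  ∏ i ∈ Finset.range b, qint (i + 1)

/-- The simple root `α_i = e_i - e_{i+1} ∈ ℤ^m` (with `1 ≤ i ≤ m-1`, one-indexed
entries realized on `Fin m`). -/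
def simpleRoot (m i : ℕ) : Fin m → ℤ :=
  fun j => (if (j : ℕ) + 1 = i then 1 else 0) - (if (j : ℕ) = i then 1 else 0)

/-- The standard dot product on `ℤ^m`. -/
def dotP {m : ℕ} (v w : Fin m → ℤ) : ℤ := ∑ j, v j * w j

/-- The highest weight `Λ = (n,…,n,0,…,0)` with `ℓ` entries equal to `n`. -/
def LambdaVec (m n ℓ : ℕ) : Fin m → ℤ := fun j => if (j : ℕ) < ℓ then (n : ℤ) else 0

/-- `N^Λ(σ, ū, t) = ⟨Λ - ∑_{j ≤ t, σ(j) < σ(t)} α_{ū_j}, α_{ū_t}⟩`. -/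
def Nwt {m N : ℕ} (Λ : Fin m → ℤ) (σ : Equiv.Perm (Fin N)) (u : Fin N → ℕ) (t : Fin N) : ℤ :=
  dotP (Λ - ∑ j ∈ Finset.univ.filter (fun j => j ≤ t ∧ σ j < σ t), simpleRoot m (u j))
    (simpleRoot m (u t))

/-- `X_σ = ∏_t [N^Λ(σ,ū,t)]·q^(N^Λ(e,ū,t) - 1)`. -/
def Xsig {m N : ℕ} (Λ : Fin m → ℤ) (σ : Equiv.Perm (Fin N)) (u : Fin N → ℕ) :
    LaurentPolynomial ℤ :=
  ∏ t : Fin N, qint (Nwt Λ σ u t) * T (Nwt Λ 1 u t - 1)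

/-- The set of possible crossings `S_ū^w̄ = {σ : ū_j = w̄_{σ(j)} for all j}`. -/
def Sset {N : ℕ} (u w : Fin N → ℕ) : Finset (Equiv.Perm (Fin N)) :=
  Finset.univ.filter fun σ => ∀ j, u j = w (σ j)

/-- The evaluation `⟪ū, w̄⟫ = ∑_{σ ∈ S_ū^w̄} X_σ`. -/
def pairing {m N : ℕ} (Λ : Fin m → ℤ) (u w : Fin N → ℕ) : LaurentPolynomial ℤ :=
  ∑ σ ∈ Sset u w, Xsig Λ σ u


/-! ### Quantum integers -/

lemma sum_T_telescope (k : ℕ) :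
    (∑ i ∈ Finset.range k, (T ((k : ℤ) - 1 - 2 * i) : LaurentPolynomial ℤ)) * (T 1 - T (-1))
      = T k - T (-k) := by
  have h := Finset.sum_range_sub' (fun i : ℕ => (T ((k : ℤ) - 2 * i) : LaurentPolynomial ℤ)) k
  rw [Finset.sum_mul]
  have h2 : ((k : ℤ) - 2 * (k : ℤ)) = -k := by ring
  simp only [h2, Nat.cast_zero, mul_zero, sub_zero] at h
  rw [← h]
  refine Finset.sum_congr rfl fun i _ => ?_
  rw [mul_sub, ← T_add, ← T_add]
  push_cast
  congr 2 <;> ring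

lemma qint_mul (a : ℤ) : qint a * (T 1 - T (-1)) = T a - T (-a) := by
  unfold qint
  split_ifs with h
  · have := sum_T_telescope a.toNat
    rwa [Int.toNat_of_nonneg h] at this
  · have := sum_T_telescope (-a).toNat
    rw [Int.toNat_of_nonneg (by omega)] at this
    rw [neg_mul, this]
    simp

lemma T_sub_ne : (T 1 - T (-1) : LaurentPolynomial ℤ) ≠ 0 := by
  intro h
  have h1 := congrArg (fun p : LaurentPolynomial ℤ => p.coeff 1) (sub_eq_zero.mp h)
  simp [T_apply] at h1

lemma qint_add (a b : ℤ) : qint a * T b + T (-a) * qint b = qint (a + b) := by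
  apply mul_right_cancel₀ T_sub_ne
  have ha := qint_mul a
  have hb := qint_mul b
  have hab := qint_mul (a + b)
  rw [hab, add_mul, mul_right_comm, ha, mul_assoc, hb, sub_mul, mul_sub, ← T_add, ← T_add,
    ← T_add, neg_add]
  ring

lemma qint_zero : qint 0 = 0 := by simp [qint]
lemma qint_one : qint 1 = 1 := by simp [qint]
lemma qint_neg_one : qint (-1) = -1 := by simp [qint]

/-! ### The dot product -/

lemma dotP_add {m : ℕ} (v v' w : Fin m → ℤ) : dotP (v + v') w = dotP v w + dotP v' w := by
  simp [dotP, add_mul, Finset.sum_add_distrib]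

lemma dotP_sub {m : ℕ} (v v' w : Fin m → ℤ) : dotP (v - v') w = dotP v w - dotP v' w := by
  simp [dotP, sub_mul, Finset.sum_sub_distrib]

lemma dotP_comm {m : ℕ} (v w : Fin m → ℤ) : dotP v w = dotP w v := by
  simp [dotP, mul_comm]

lemma simpleRoot_eq {M : ℕ} (i : Fin M) :
    simpleRoot (M + 1) (i + 1) = Pi.single i.castSucc 1 - Pi.single i.succ 1 := by
  funext j
  simp [simpleRoot, Pi.single_apply, Fin.ext_iff]

lemma dotP_simpleRoot {M : ℕ} (v : Fin (M + 1) → ℤ) (i : Fin M) :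
    dotP v (simpleRoot (M + 1) (i + 1)) = v i.castSucc - v i.succ := by
  rw [simpleRoot_eq, dotP_comm, dotP_sub]
  simp [dotP, Pi.single_apply]

/-! ### Representations by matrices -/

open Kronecker in
/-- Weight representations (without Serre relations). -/
structure IsRep {I B : Type} {m : ℕ} [DecidableEq I] [Fintype B] [DecidableEq B]
    (α : I → Fin m → ℤ) (wt : B → Fin m → ℤ)
    (E F : I → Matrix B B (LaurentPolynomial ℤ)) : Prop where
  hE : ∀ i b' b, E i b' b ≠ 0 → wt b' = wt b + α i
  hF : ∀ i b' b, F i b' b ≠ 0 → wt b' = wt b - α i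
  comm : ∀ i j, E i * F j - F j * E i =
    if i = j then Matrix.diagonal (fun b => qint (dotP (wt b) (α i))) else 0

section Tensor
open Kronecker

variable {I A B : Type} {m : ℕ} [DecidableEq I] [Fintype B] [DecidableEq B]
  [Fintype A] [DecidableEq A]

/-- Cartan element. -/
def Kd (α : I → Fin m → ℤ) (wt : B → Fin m → ℤ) (s : ℤ) (i : I) :
    Matrix B B (LaurentPolynomial ℤ) :=
  Matrix.diagonal (fun b => T (s * dotP (wt b) (α i)))

/-- Tensor product action of `E`. -/
def tE (α : I → Fin m → ℤ) (wtB : B → Fin m → ℤ)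
    (EA : I → Matrix A A (LaurentPolynomial ℤ)) (EB : I → Matrix B B (LaurentPolynomial ℤ))
    (i : I) : Matrix (A × B) (A × B) (LaurentPolynomial ℤ) :=
  EA i ⊗ₖ Kd α wtB 1 i + 1 ⊗ₖ EB i

/-- Tensor product action of `F`. -/
def tF (α : I → Fin m → ℤ) (wtA : A → Fin m → ℤ)
    (FA : I → Matrix A A (LaurentPolynomial ℤ)) (FB : I → Matrix B B (LaurentPolynomial ℤ))
    (i : I) : Matrix (A × B) (A × B) (LaurentPolynomial ℤ) :=
  FA i ⊗ₖ 1 + Kd α wtA (-1) i ⊗ₖ FB i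

theorem IsRep.tensor {α : I → Fin m → ℤ} {wtA : A → Fin m → ℤ} {wtB : B → Fin m → ℤ}
    {EA FA : I → Matrix A A (LaurentPolynomial ℤ)} {EB FB : I → Matrix B B (LaurentPolynomial ℤ)}
    (hA : IsRep α wtA EA FA) (hB : IsRep α wtB EB FB) :
    IsRep α (fun p : A × B => wtA p.1 + wtB p.2) (tE α wtB EA EB) (tF α wtA FA FB) where
  hE := by
    rintro i ⟨a', b'⟩ ⟨a, b⟩ h
    simp only [tE, Kd, Matrix.add_apply, Matrix.kronecker_apply] at h
    by_cases h1 : EA i a' a * (Matrix.diagonal (fun b => T (1 * dotP (wtB b) (α i)))) b' b = 0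
    · rw [h1, zero_add] at h
      have h2 := left_ne_zero_of_mul h
      have h3 := hB.hE _ _ _ (right_ne_zero_of_mul h)
      have h4 : a' = a := by
        by_contra hne
        exact h2 (Matrix.one_apply_ne hne)
      simp only [h3, h4]
      abel
    · have h3 := hA.hE _ _ _ (left_ne_zero_of_mul h1)
      have h2 := right_ne_zero_of_mul h1
      have h4 : b' = b := by
        by_contra hne
        exact h2 (Matrix.diagonal_apply_ne _ hne)
      simp only [h3, h4]
      abel
  hF := by
    rintro i ⟨a', b'⟩ ⟨a, b⟩ h
    simp only [tF, Kd, Matrix.add_apply, Matrix.kronecker_apply] at h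
    by_cases h1 : FA i a' a * (1 : Matrix B B (LaurentPolynomial ℤ)) b' b = 0
    · rw [h1, zero_add] at h
      have h2 := left_ne_zero_of_mul h
      have h3 := hB.hF _ _ _ (right_ne_zero_of_mul h)
      have h4 : a' = a := by
        by_contra hne
        exact h2 (Matrix.diagonal_apply_ne _ hne)
      simp only [h3, h4]
      abel
    · have h3 := hA.hF _ _ _ (left_ne_zero_of_mul h1)
      have h2 := right_ne_zero_of_mul h1
      have h4 : b' = b := by
        by_contra hne
        exact h2 (Matrix.one_apply_ne hne)
      simp only [h3, h4]
      abel
  comm := by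
    intro i j
    have cross : (EA i * Kd α wtA (-1) j) ⊗ₖ (Kd α wtB 1 i * FB j) =
        (Kd α wtA (-1) j * EA i) ⊗ₖ (FB j * Kd α wtB 1 i) := by
      ext1 ⟨a', b'⟩ ⟨a, b⟩
      simp only [Kd, Matrix.kronecker_apply, Matrix.mul_diagonal, Matrix.diagonal_mul]
      by_cases h1 : EA i a' a = 0
      · simp [h1]
      by_cases h2 : FB j b' b = 0
      · simp [h2]
      rw [hA.hE _ _ _ h1, hB.hF _ _ _ h2, dotP_add, dotP_sub, dotP_comm (α j) (α i)]
      have : (T (-1 * dotP (wtA a) (α j)) : LaurentPolynomial ℤ) *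
          T (1 * (dotP (wtB b) (α i) - dotP (α i) (α j))) =
          T (-1 * (dotP (wtA a) (α j) + dotP (α i) (α j))) * T (1 * dotP (wtB b) (α i)) := by
        rw [← T_add, ← T_add]
        congr 1
        ring
      linear_combination (EA i a' a * FB j b' b) * this
    have cA := hA.comm i j
    have cB := hB.comm i j
    have expand : tE α wtB EA EB i * tF α wtA FA FB j - tF α wtA FA FB j * tE α wtB EA EB i =
        (EA i * FA j - FA j * EA i) ⊗ₖ Kd α wtB 1 i +
        Kd α wtA (-1) j ⊗ₖ (EB i * FB j - FB j * EB i) := by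
      have e1 : (EA i * FA j - FA j * EA i) ⊗ₖ Kd α wtB 1 i =
          (EA i * FA j) ⊗ₖ Kd α wtB 1 i - (FA j * EA i) ⊗ₖ Kd α wtB 1 i := by
        ext1 ⟨a', b'⟩ ⟨a, b⟩; simp [sub_mul]
      have e2 : Kd α wtA (-1) j ⊗ₖ (EB i * FB j - FB j * EB i) =
          Kd α wtA (-1) j ⊗ₖ (EB i * FB j) - Kd α wtA (-1) j ⊗ₖ (FB j * EB i) := by
        ext1 ⟨a', b'⟩ ⟨a, b⟩; simp [mul_sub]
      rw [e1, e2]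
      simp only [tE, tF, add_mul, mul_add, ← Matrix.mul_kronecker_mul, one_mul, mul_one, cross]
      abel
    rw [expand, cA, cB]
    split_ifs with hij
    · subst hij
      ext1 ⟨a', b'⟩ ⟨a, b⟩
      simp only [Kd, Matrix.add_apply, Matrix.kronecker_apply, Matrix.diagonal_apply,
        Prod.mk.injEq]
      by_cases h1 : a' = a <;> by_cases h2 : b' = b <;> simp [h1, h2]
      rw [dotP_add, ← qint_add]
      ring
    · simp

end Tensor

/-! ### The fundamental representation -/

section Fund
variable {M : ℕ}

/-- weights of the exterior algebra -/
def fwt (S : Fin (M + 1) → Bool) : Fin (M + 1) → ℤ := fun j => if S j then 1 else 0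

/-- swap the two positions -/
def fsw (i : Fin M) (S : Fin (M + 1) → Bool) : Fin (M + 1) → Bool :=
  S ∘ Equiv.swap i.castSucc i.succ

/-- raising -/
def fE (i : Fin M) : Matrix (Fin (M + 1) → Bool) (Fin (M + 1) → Bool) (LaurentPolynomial ℤ) :=
  fun S' S => if S' = fsw i S then (if S i.castSucc = false ∧ S i.succ = true then 1 else 0) else 0

/-- lowering -/
def fF (i : Fin M) : Matrix (Fin (M + 1) → Bool) (Fin (M + 1) → Bool) (LaurentPolynomial ℤ) :=
  fun S' S => if S' = fsw i S then (if S i.castSucc = true ∧ S i.succ = false then 1 else 0) else 0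

lemma fsw_fsw (i : Fin M) (S : Fin (M + 1) → Bool) : fsw i (fsw i S) = S := by
  funext j; simp [fsw]

lemma fsw_castSucc (i : Fin M) (S : Fin (M + 1) → Bool) : fsw i S i.castSucc = S i.succ := by
  simp [fsw]

lemma fsw_succ (i : Fin M) (S : Fin (M + 1) → Bool) : fsw i S i.succ = S i.castSucc := by
  simp [fsw]

lemma fsw_other (i : Fin M) (S : Fin (M + 1) → Bool) (j : Fin (M + 1)) (h : j ≠ i.castSucc)
    (h' : j ≠ i.succ) : fsw i S j = S j := by
  simp [fsw, Equiv.swap_apply_of_ne_of_ne h h']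

lemma fsw_comm (i j : Fin M) (h1 : i.castSucc ≠ j.castSucc) (h2 : i.succ ≠ j.succ)
    (h3 : i.castSucc ≠ j.succ) (h4 : i.succ ≠ j.castSucc) (S : Fin (M + 1) → Bool) :
    fsw i (fsw j S) = fsw j (fsw i S) := by
  funext k
  by_cases a1 : k = i.castSucc
  · subst a1
    rw [fsw_castSucc, fsw_other j _ _ h4 h2, fsw_other j _ _ h1 h3, fsw_castSucc]
  by_cases a2 : k = i.succ
  · subst a2
    rw [fsw_succ, fsw_other j _ _ h1 h3, fsw_other j _ _ h4 h2, fsw_succ]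
  rw [fsw_other i _ _ a1 a2]
  by_cases a3 : k = j.castSucc
  · subst a3
    rw [fsw_castSucc, fsw_castSucc, fsw_other i _ _ h3.symm h2.symm]
  by_cases a4 : k = j.succ
  · subst a4
    rw [fsw_succ, fsw_succ, fsw_other i _ _ h1.symm h4.symm]
  rw [fsw_other j _ _ a3 a4, fsw_other j _ _ a3 a4, fsw_other i _ _ a1 a2]

lemma fE_mul_fF (i j : Fin M) (S' S : Fin (M + 1) → Bool) :
    (fE i * fF j) S' S = if S' = fsw i (fsw j S) ∧
      (fsw j S i.castSucc = false ∧ fsw j S i.succ = true) ∧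
      (S j.castSucc = true ∧ S j.succ = false) then 1 else 0 := by
  rw [Matrix.mul_apply]
  simp only [fE, fF, mul_ite, mul_zero, Finset.sum_ite_eq', Finset.sum_ite_eq, Finset.mem_univ,
    if_true, mul_one]
  grind

lemma fF_mul_fE (i j : Fin M) (S' S : Fin (M + 1) → Bool) :
    (fF j * fE i) S' S = if S' = fsw j (fsw i S) ∧
      (fsw i S j.castSucc = true ∧ fsw i S j.succ = false) ∧
      (S i.castSucc = false ∧ S i.succ = true) then 1 else 0 := by
  rw [Matrix.mul_apply]
  simp only [fE, fF, mul_ite, mul_zero, Finset.sum_ite_eq', Finset.sum_ite_eq, Finset.mem_univ,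
    if_true, mul_one]
  grind

lemma fwt_fsw (i : Fin M) (S : Fin (M + 1) → Bool) :
    fwt (fsw i S) = fwt S + (fwt S i.succ - fwt S i.castSucc : ℤ) • simpleRoot (M + 1) (i + 1) := by
  rw [simpleRoot_eq]
  have hne : i.castSucc ≠ i.succ := (Fin.castSucc_lt_succ).ne
  funext k
  rw [Pi.add_apply, Pi.smul_apply, smul_eq_mul]
  by_cases a1 : k = i.castSucc
  · subst a1
    simp [fwt, fsw_castSucc, Pi.single_apply, hne]
  by_cases a2 : k = i.succ
  · subst a2
    simp [fwt, fsw_succ, Pi.single_apply, hne.symm]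
  simp [fwt, fsw_other i S k a1 a2, Pi.single_apply, a1, a2]

theorem fund_isRep :
    IsRep (fun i : Fin M => simpleRoot (M + 1) (i + 1)) fwt fE fF where
  hE := by
    intro i S' S h
    simp only [fE, ne_eq, ite_eq_right_iff, Classical.not_imp] at h
    obtain ⟨h1, ⟨h2, h3⟩, -⟩ := h
    rw [h1, fwt_fsw]
    simp [fwt, h2, h3]
  hF := by
    intro i S' S h
    simp only [fF, ne_eq, ite_eq_right_iff, Classical.not_imp] at h
    obtain ⟨h1, ⟨h2, h3⟩, -⟩ := h
    rw [h1, fwt_fsw]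
    simp [fwt, h2, h3, sub_eq_add_neg]
  comm := by
    intro i j
    ext1 S' S
    rw [Matrix.sub_apply, fE_mul_fF, fF_mul_fE]
    by_cases hij : i = j
    · subst hij
      rw [if_pos rfl, Matrix.diagonal_apply, dotP_simpleRoot]
      simp only [fsw_fsw, fsw_castSucc, fsw_succ, fwt]
      by_cases hS : S' = S
      · subst hS
        cases h1 : S' i.castSucc <;> cases h2 : S' i.succ <;>
          simp [qint_zero, qint_one, qint_neg_one]
      · simp [hS]
    · rw [if_neg hij, Matrix.zero_apply]
      have h1 : i.castSucc ≠ j.castSucc := by simpa using hij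
      have h2 : i.succ ≠ j.succ := by simpa using hij
      by_cases h3 : i.castSucc = j.succ
      · rw [if_neg, if_neg, sub_zero]
        · rintro ⟨-, ⟨-, h⟩, h', h''⟩
          rw [← h3, fsw_castSucc, h''] at h
          exact absurd h (by decide)
        · rintro ⟨-, ⟨h, -⟩, h', h''⟩
          rw [h3, fsw_succ, h'] at h
          exact absurd h (by decide)
      by_cases h4 : i.succ = j.castSucc
      · rw [if_neg, if_neg, sub_zero]
        · rintro ⟨-, ⟨h, -⟩, h', h''⟩
          rw [← h4, fsw_succ, h'] at h
          exact absurd h (by decide)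
        · rintro ⟨-, ⟨-, h⟩, h', h''⟩
          rw [h4, fsw_castSucc, h''] at h
          exact absurd h (by decide)
      rw [fsw_comm i j h1 h2 h3 h4, fsw_other j _ _ h1 h3, fsw_other j _ _ h4 h2,
        fsw_other i _ _ h1.symm (Ne.symm h4), fsw_other i _ _ (Ne.symm h3) h2.symm, sub_eq_zero]
      congr 1
      rw [eq_iff_iff]
      tauto

end Fund

/-! ### Combinatorics of the pairing -/

section Comb
variable {I : Type} {m : ℕ} [DecidableEq I]

/-- Extend a permutation by sending `t` to the last element. -/
def extPerm {N : ℕ} (t : Fin (N + 1)) (σ : Equiv.Perm (Fin N)) : Equiv.Perm (Fin (N + 1)) :=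
  ((finSuccEquiv' t).trans (Equiv.optionCongr σ)).trans (finSuccEquiv' (Fin.last N)).symm

lemma extPerm_self {N : ℕ} (t : Fin (N + 1)) (σ : Equiv.Perm (Fin N)) :
    extPerm t σ t = Fin.last N := by
  simp [extPerm]

lemma extPerm_succAbove {N : ℕ} (t : Fin (N + 1)) (σ : Equiv.Perm (Fin N)) (s : Fin N) :
    extPerm t σ (t.succAbove s) = (σ s).castSucc := by
  simp [extPerm]

lemma extPerm_bij (N : ℕ) :
    Function.Bijective (fun p : Fin (N + 1) × Equiv.Perm (Fin N) => extPerm p.1 p.2) := by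
  rw [Fintype.bijective_iff_injective_and_card]
  constructor
  · rintro ⟨t, σ⟩ ⟨t', σ'⟩ h
    simp only at h
    have h1 : t = t' := by
      apply (extPerm t σ).injective
      rw [extPerm_self, h, extPerm_self]
    subst h1
    have h2 : σ = σ' := by
      ext s
      have := extPerm_succAbove t σ s
      rw [h, extPerm_succAbove] at this
      simpa using congrArg Fin.val this.symm
    rw [h2]
  · simp [Fintype.card_perm, Nat.factorial_succ]

/-- generic weight -/
def gN (α : I → Fin m → ℤ) (Λ : Fin m → ℤ) {N : ℕ} (σ : Equiv.Perm (Fin N)) (u : Fin N → I)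
    (t : Fin N) : ℤ :=
  dotP (Λ - ∑ j, if j ≤ t ∧ σ j < σ t then α (u j) else 0) (α (u t))

/-- generic pairing, without powers of `q` -/
def gP (α : I → Fin m → ℤ) (Λ : Fin m → ℤ) {N : ℕ} (u w : Fin N → I) : LaurentPolynomial ℤ :=
  ∑ σ : Equiv.Perm (Fin N), if ∀ j, u j = w (σ j) then ∏ t, qint (gN α Λ σ u t) else 0

lemma gN_ext_self (α : I → Fin m → ℤ) (Λ : Fin m → ℤ) {N : ℕ} (σ : Equiv.Perm (Fin N))
    (u : Fin (N + 1) → I) (t : Fin (N + 1)) :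
    gN α Λ (extPerm t σ) u t = dotP (Λ - ∑ j, if j < t then α (u j) else 0) (α (u t)) := by
  unfold gN
  congr 2
  refine Finset.sum_congr rfl fun j _ => ?_
  congr 1
  rw [extPerm_self, eq_iff_iff]
  constructor
  · rintro ⟨h1, h2⟩
    refine lt_of_le_of_ne h1 ?_
    rintro rfl
    simp [extPerm_self] at h2
  · intro h
    refine ⟨h.le, lt_of_le_of_ne (Fin.le_last _) ?_⟩
    rw [← extPerm_self t σ]
    exact fun h' => h.ne ((extPerm t σ).injective h')

lemma gN_ext_succAbove (α : I → Fin m → ℤ) (Λ : Fin m → ℤ) {N : ℕ} (σ : Equiv.Perm (Fin N))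
    (u : Fin (N + 1) → I) (t : Fin (N + 1)) (s : Fin N) :
    gN α Λ (extPerm t σ) u (t.succAbove s) = gN α Λ σ (u ∘ t.succAbove) s := by
  unfold gN
  rw [Fin.sum_univ_succAbove _ t]
  simp only [extPerm_self, extPerm_succAbove, Fin.succAbove_le_succAbove_iff,
    Fin.castSucc_lt_castSucc_iff, Function.comp_apply]
  rw [if_neg (by simp [Fin.le_last]), zero_add]

lemma gP_succ (α : I → Fin m → ℤ) (Λ : Fin m → ℤ) {N : ℕ} (u w : Fin (N + 1) → I) :
    gP α Λ u w = ∑ t, if u t = w (Fin.last N) then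
      qint (dotP (Λ - ∑ j, if j < t then α (u j) else 0) (α (u t))) *
        gP α Λ (u ∘ t.succAbove) (w ∘ Fin.castSucc) else 0 := by
  unfold gP
  rw [← (extPerm_bij N).sum_comp, Fintype.sum_prod_type]
  refine Finset.sum_congr rfl fun t _ => ?_
  simp only [Fin.forall_iff_succAbove t, extPerm_self, extPerm_succAbove,
    Fin.prod_univ_succAbove _ t, gN_ext_self, gN_ext_succAbove, Function.comp_apply]
  by_cases h : u t = w (Fin.last N)
  · simp [h, Finset.mul_sum]
  · simp [h]

end Comb

/-! ### Operators applied to the highest weight vector -/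

section Act
variable {I B : Type} {m : ℕ} [DecidableEq I] [Fintype B] [DecidableEq B]

/-- `F_{u_N} ⋯ F_{u_1} v` -/
def Fv (F : I → Matrix B B (LaurentPolynomial ℤ)) (v : B → LaurentPolynomial ℤ) :
    (N : ℕ) → (Fin N → I) → (B → LaurentPolynomial ℤ)
  | 0, _ => v
  | N + 1, u => (F (u (Fin.last N))).mulVec (Fv F v N (u ∘ Fin.castSucc))

/-- `E_{w_1} ⋯ E_{w_N} x` -/
def Ew (E : I → Matrix B B (LaurentPolynomial ℤ)) :
    (N : ℕ) → (Fin N → I) → Matrix B B (LaurentPolynomial ℤ)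
  | 0, _ => 1
  | N + 1, w => Ew E N (w ∘ Fin.castSucc) * E (w (Fin.last N))

variable {α : I → Fin m → ℤ} {wt : B → Fin m → ℤ} {E F : I → Matrix B B (LaurentPolynomial ℤ)}

lemma Fv_wt (h : IsRep α wt E F) {v : B → LaurentPolynomial ℤ} {Λ : Fin m → ℤ}
    (hv : ∀ b, v b ≠ 0 → wt b = Λ) :
    ∀ (N : ℕ) (u : Fin N → I) (b : B), Fv F v N u b ≠ 0 → wt b = Λ - ∑ t, α (u t) := by
  intro N
  induction N with
  | zero => intro u b hb; simpa using hv b hb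
  | succ N ih =>
    intro u b hb
    simp only [Fv, Matrix.mulVec, dotProduct] at hb
    obtain ⟨c, -, hc⟩ := Finset.exists_ne_zero_of_sum_ne_zero hb
    rw [h.hF _ _ _ (left_ne_zero_of_mul hc), ih _ _ (right_ne_zero_of_mul hc),
      Fin.sum_univ_castSucc]
    simp only [Function.comp_apply]
    abel

lemma E_F_apply (h : IsRep α wt E F) (i j : I) (x : B → LaurentPolynomial ℤ) (μ : Fin m → ℤ)
    (hx : ∀ b, x b ≠ 0 → wt b = μ) :
    (E i).mulVec ((F j).mulVec x) = (F j).mulVec ((E i).mulVec x) +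
      if j = i then qint (dotP μ (α j)) • x else 0 := by
  have hc := h.comm i j
  rw [sub_eq_iff_eq_add'] at hc
  rw [Matrix.mulVec_mulVec, hc, Matrix.add_mulVec, Matrix.mulVec_mulVec]
  congr 1
  by_cases hij : i = j
  · subst hij
    simp only [if_true]
    funext b
    rw [Matrix.mulVec_diagonal]
    by_cases hb : x b = 0
    · simp [hb]
    · simp [hx b hb]
  · simp [hij, Ne.symm hij]

lemma E_Fv (h : IsRep α wt E F) {v : B → LaurentPolynomial ℤ} {Λ : Fin m → ℤ}
    (hv : ∀ b, v b ≠ 0 → wt b = Λ) (hE : ∀ i, (E i).mulVec v = 0) (i : I) :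
    ∀ (N : ℕ) (u : Fin (N + 1) → I), (E i).mulVec (Fv F v (N + 1) u) =
      ∑ t, if u t = i then qint (dotP (Λ - ∑ j, if j < t then α (u j) else 0) (α (u t))) •
        Fv F v N (u ∘ t.succAbove) else 0 := by
  intro N
  induction N with
  | zero =>
    intro u
    rw [Fv, E_F_apply h i _ _ Λ (by simpa [Fv] using hv)]
    simp [Fv, hE]
  | succ N ih =>
    intro u
    rw [Fv, E_F_apply h i _ _ _ (Fv_wt h hv (N + 1) _), ih, Fin.sum_univ_castSucc (n := N + 1)]
    congr 1
    · rw [Matrix.mulVec_sum]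
      refine Finset.sum_congr rfl fun s _ => ?_
      have hs : Fv F v (N + 1) (u ∘ s.castSucc.succAbove) =
          (F (u (Fin.last (N + 1)))).mulVec (Fv F v N ((u ∘ Fin.castSucc) ∘ s.succAbove)) := by
        rw [Fv]
        congr 2
        · congr 1
          simp [Fin.succAbove_last]
        · funext k
          simp [Fin.castSucc_succAbove_castSucc]
      rw [hs, Fin.sum_univ_castSucc (n := N + 1)]
      simp only [Function.comp_apply, Fin.castSucc_lt_castSucc_iff]
      rw [if_neg (not_lt.mpr (Fin.le_last _)), add_zero]
      split_ifs
      · rw [Matrix.mulVec_smul]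
      · simp
    · rw [Fin.sum_univ_castSucc (n := N + 1)]
      simp [Fin.castSucc_lt_last, Fin.succAbove_last, Function.comp_def]

theorem Ew_Fv (h : IsRep α wt E F) {v : B → LaurentPolynomial ℤ} {Λ : Fin m → ℤ}
    (hv : ∀ b, v b ≠ 0 → wt b = Λ) (hE : ∀ i, (E i).mulVec v = 0) :
    ∀ (N : ℕ) (u w : Fin N → I), (Ew E N w).mulVec (Fv F v N u) = gP α Λ u w • v := by
  intro N
  induction N with
  | zero => intro u w; simp [Ew, Fv, gP]
  | succ N ih =>
    intro u w
    rw [Ew, ← Matrix.mulVec_mulVec, E_Fv h hv hE, Matrix.mulVec_sum, gP_succ, Finset.sum_smul]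
    refine Finset.sum_congr rfl fun t _ => ?_
    split_ifs
    · rw [Matrix.mulVec_smul, ih, smul_smul]
    · simp

end Act

/-! ### Existence of the representation -/

theorem exists_rep (M ℓ n : ℕ) :
    ∃ (B : Type) (_ : Fintype B) (_ : DecidableEq B) (wt : B → Fin (M + 1) → ℤ)
      (E F : Fin M → Matrix B B (LaurentPolynomial ℤ)) (b₀ : B),
      IsRep (fun i : Fin M => simpleRoot (M + 1) (i + 1)) wt E F ∧
      wt b₀ = LambdaVec (M + 1) n ℓ ∧ (∀ i b, E i b b₀ = 0) ∧
      ∀ b j, 0 ≤ wt b j ∧ wt b j ≤ n := by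
  induction n with
  | zero =>
    refine ⟨Unit, inferInstance, inferInstance, 0, 0, 0, (), ⟨?_, ?_, ?_⟩, ?_, ?_, ?_⟩
    · simp
    · simp
    · intro i j
      ext
      by_cases hij : i = j <;> simp [hij, dotP, qint_zero]
    · funext j
      simp [LambdaVec]
    · simp
    · simp
  | succ n ih =>
    obtain ⟨B, _, _, wt, E, F, b₀, hR, hw, hE, hb⟩ := ih
    refine ⟨B × (Fin (M + 1) → Bool), inferInstance, inferInstance, _, _, _,
      (b₀, fun j => decide ((j : ℕ) < ℓ)), hR.tensor fund_isRep, ?_, ?_, ?_⟩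
    · funext j
      simp only [hw, Pi.add_apply, fwt, LambdaVec, decide_eq_true_eq]
      split_ifs <;> simp
    · rintro i ⟨b', S'⟩
      simp only [tE, Matrix.add_apply, Matrix.kroneckerMap_apply, hE, zero_mul, zero_add, fE,
        decide_eq_true_eq, decide_eq_false_iff_not, Fin.val_castSucc, Fin.val_succ]
      rw [if_neg (c := _ ∧ _) (by omega)]
      simp
    · rintro ⟨b, S⟩ j
      have := hb b j
      simp only [Pi.add_apply, fwt]
      push_cast
      split_ifs <;> omega

/-- If the target weight `k⃗ = Λ - ∑_t α_{ū_t}` has an entry that is negative or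
strictly greater than `n`, then the closed formula evaluates to zero. -/
theorem pairing_eq_zero_of_label_out_of_range (m n ℓ N : ℕ)
    (hm : 2 ≤ m) (hn : 1 ≤ n) (hℓ : ℓ ≤ m)
    (u w : Fin N → ℕ) (hu : ∀ t, 1 ≤ u t ∧ u t ≤ m - 1) (hw : ∀ t, 1 ≤ w t ∧ w t ≤ m - 1)
    (j : Fin m)
    (hj : (LambdaVec m n ℓ - ∑ t : Fin N, simpleRoot m (u t)) j < 0 ∨
      (n : ℤ) < (LambdaVec m n ℓ - ∑ t : Fin N, simpleRoot m (u t)) j) :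
    pairing (LambdaVec m n ℓ) u w = 0 := by
  obtain ⟨M, rfl⟩ : ∃ M, m = M + 1 := ⟨m - 1, by omega⟩
  obtain ⟨u', rfl⟩ : ∃ u' : Fin N → Fin M, u = fun t => (u' t : ℕ) + 1 :=
    ⟨fun t => ⟨u t - 1, by have := hu t; omega⟩, by funext t; have := hu t; simp; omega⟩
  obtain ⟨w', rfl⟩ : ∃ w' : Fin N → Fin M, w = fun t => (w' t : ℕ) + 1 :=
    ⟨fun t => ⟨w t - 1, by have := hw t; omega⟩, by funext t; have := hw t; simp; omega⟩
  obtain ⟨B, _, _, wt, E, F, b₀, hR, hw0, hE, hb⟩ := exists_rep M ℓ n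
  have hv : ∀ b, (Pi.single b₀ 1 : B → LaurentPolynomial ℤ) b ≠ 0 →
      wt b = LambdaVec (M + 1) n ℓ := by
    intro b h
    by_cases hbb : b = b₀
    · rw [hbb, hw0]
    · simp [hbb] at h
  have hEv : ∀ i, (E i).mulVec (Pi.single b₀ 1 : B → LaurentPolynomial ℤ) = 0 := by
    intro i
    funext b
    simp [hE]
  have key := Ew_Fv hR hv hEv N u' w'
  have hF0 : Fv F (Pi.single b₀ 1 : B → LaurentPolynomial ℤ) N u' = 0 := by
    funext b
    by_contra hne
    have h1 := Fv_wt hR hv N u' b hne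
    have h2 := hb b j
    rw [h1] at h2
    simp only at hj
    omega
  rw [hF0, Matrix.mulVec_zero] at key
  have hP : gP (fun i : Fin M => simpleRoot (M + 1) (i + 1)) (LambdaVec (M + 1) n ℓ) u' w' = 0 := by
    have := congrFun key b₀
    simpa using this.symm
  have hfac : pairing (LambdaVec (M + 1) n ℓ) (fun t => (u' t : ℕ) + 1) (fun t => (w' t : ℕ) + 1) =
      gP (fun i : Fin M => simpleRoot (M + 1) (i + 1)) (LambdaVec (M + 1) n ℓ) u' w' *
      ∏ t, T (Nwt (LambdaVec (M + 1) n ℓ) 1 (fun t => (u' t : ℕ) + 1) t - 1) := by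
    unfold pairing gP Sset
    rw [Finset.sum_filter, Finset.sum_mul]
    refine Finset.sum_congr rfl fun σ _ => ?_
    simp only [Nat.add_right_cancel_iff, Fin.val_inj, ite_mul, zero_mul]
    congr 1
    simp only [Xsig, Finset.prod_mul_distrib]
    congr 1
    refine Finset.prod_congr rfl fun t _ => ?_
    simp only [Nwt, gN, Finset.sum_filter]
  rw [hfac, hP, zero_mul]

end
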